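/- arXiv:2510.15295 — 2 statements merged into one kernel-verified Lean document; each statement's English description precedes it below -/
import Mathlib

section
/- Let M be a positive integer, θ_u, θ_s, φ ∈ ℝ, and set ζ₁ = (θ_u − θ_s)/2, ζ₂ = (θ_u + θ_s)/2, and x = sin ζ₁ · cos(ζ₂ − φ). Define ρ(φ) = |⟨a_M(θ_u − φ), a_M(θ_s − φ)⟩| / M. If sin(πx) ≠ 0 then ρ(φ) = |sin(Mπx)| / (M·|sin(πx)|), and if sin(πx) = 0 then ρ(φ) = 1. -/
open scoped ComplexInnerProductSpace

/-- Uniform-linear-array steering vector: `m`-th entry `e^{iπ m sin θ}` for `m = 0, …, M−1`. -/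
noncomputable def steer (M : ℕ) (θ : ℝ) : EuclideanSpace ℂ (Fin M) :=
  WithLp.toLp 2 fun m => Complex.exp (Complex.I * Real.pi * (m : ℂ) * (Real.sin θ : ℂ))

theorem steer_inner (M : ℕ) (a b y : ℝ) (h : Real.sin a - Real.sin b = 2 * y) :
    ⟪steer M a, steer M b⟫
      = ∑ i ∈ Finset.range M, Complex.exp (Complex.I * ((-(2 * (Real.pi * y)) : ℝ) : ℂ)) ^ i := by
  rw [PiLp.inner_apply, Finset.sum_range]
  refine Finset.sum_congr rfl fun m _ => ?_
  have hc : (Real.sin a : ℂ) = Real.sin b + 2 * y := by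
    have : Real.sin a = Real.sin b + 2 * y := by linarith
    rw [this]; push_cast; ring
  simp only [steer, RCLike.inner_apply, ← Complex.exp_conj, ← Complex.exp_nat_mul,
    ← Complex.exp_add, map_mul, Complex.conj_I, Complex.conj_ofReal, map_natCast]
  congr 1
  rw [hc]
  push_cast
  ring

/-- eq. (10): with `ζ₁ = (θ_u − θ_s)/2`, `ζ₂ = (θ_u + θ_s)/2` and
`x = sin ζ₁ · cos(ζ₂ − φ)`, the correlation coefficient
`ρ(φ) = |⟨a_M(θ_u − φ), a_M(θ_s − φ)⟩|/M` equals `|sin(Mπx)|/(M|sin(πx)|)` if `sin(πx) ≠ 0`,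
and `1` if `sin(πx) = 0`. -/
theorem stmt_4 (M : ℕ) (hM : 0 < M) (θu θs φ : ℝ)
    (ζ1 ζ2 x : ℝ) (hζ1 : ζ1 = (θu - θs) / 2) (hζ2 : ζ2 = (θu + θs) / 2)
    (hx : x = Real.sin ζ1 * Real.cos (ζ2 - φ)) :
    (Real.sin (Real.pi * x) ≠ 0 →
      ‖⟪steer M (θu - φ), steer M (θs - φ)⟫‖ / M
        = |Real.sin (M * Real.pi * x)| / (M * |Real.sin (Real.pi * x)|)) ∧
    (Real.sin (Real.pi * x) = 0 →
      ‖⟪steer M (θu - φ), steer M (θs - φ)⟫‖ / M = 1) := by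
  have h : Real.sin (θu - φ) - Real.sin (θs - φ) = 2 * x := by
    rw [Real.sin_sub_sin, hx, hζ1, hζ2]
    ring_nf
  have hM' : (M : ℝ) ≠ 0 := by exact_mod_cast hM.ne'
  rw [steer_inner M _ _ x h]
  have key := mul_geom_sum (Complex.exp (Complex.I * ((-(2 * (Real.pi * x)) : ℝ) : ℂ))) M
  have e1 := Complex.norm_exp_I_mul_ofReal_sub_one (-(2 * (Real.pi * x)))
  have e2 := Complex.norm_exp_I_mul_ofReal_sub_one (-(2 * (M * Real.pi * x)))
  have e3 : Complex.exp (Complex.I * ((-(2 * (Real.pi * x)) : ℝ) : ℂ)) ^ M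
      = Complex.exp (Complex.I * ((-(2 * (M * Real.pi * x)) : ℝ) : ℂ)) := by
    rw [← Complex.exp_nat_mul]
    congr 1
    push_cast
    ring
  rw [show -(2 * (Real.pi * x)) / 2 = -(Real.pi * x) by ring, Real.sin_neg, norm_mul, norm_neg,
    Real.norm_eq_abs, Real.norm_eq_abs, abs_two] at e1
  rw [show -(2 * (M * Real.pi * x)) / 2 = -(M * Real.pi * x) by ring, Real.sin_neg, norm_mul,
    norm_neg, Real.norm_eq_abs, Real.norm_eq_abs, abs_two] at e2
  constructor
  · intro hs
    have k := congrArg norm key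
    rw [e3, norm_mul, e1, e2] at k
    have hs' : |Real.sin (Real.pi * x)| ≠ 0 := abs_ne_zero.mpr hs
    rw [div_eq_div_iff hM' (mul_ne_zero hM' hs')]
    linear_combination (M : ℝ) / 2 * k
  · intro hs
    rw [hs, abs_zero, mul_zero, norm_eq_zero, sub_eq_zero] at e1
    rw [e1]
    simp [hM']
end

section
/- Let M be a positive integer and θ_u, θ_s ∈ ℝ, and set ζ₁ = (θ_u − θ_s)/2, ζ₂ = (θ_u + θ_s)/2. Define ρ(φ) = |⟨a_M(θ_u − φ), a_M(θ_s − φ)⟩| / M for φ ∈ ℝ. Then ρ(φ) ≤ 1 for all φ, and if M ≥ 2, ρ(φ) = 1 if and only if sin ζ₁ · cos(ζ₂ − φ) is an integer. In particular, the supremum of ρ over φ ∈ ℝ equals 1. -/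
open scoped ComplexInnerProductSpace

theorem aux_inner (M : ℕ) (a b : ℝ) (x : ℝ) (h : Real.sin b - Real.sin a = -2 * x) :
    ⟪steer M a, steer M b⟫ =
      ∑ m ∈ Finset.range M, (Complex.exp (((-x : ℝ) : ℂ) * (2 * Real.pi * Complex.I))) ^ m := by
  rw [Finset.sum_range, PiLp.inner_apply]
  refine Finset.sum_congr rfl fun m _ => ?_
  have h' : (Real.sin b : ℂ) = Real.sin a - 2 * x := by
    have : Real.sin b = Real.sin a - 2 * x := by linarith
    rw [this]; push_cast; ring
  simp only [steer, RCLike.inner_apply]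
  rw [← Complex.exp_conj, ← Complex.exp_nat_mul, ← Complex.exp_add, h']
  congr 1
  simp only [map_mul, Complex.conj_I, Complex.conj_ofReal, Complex.conj_natCast, map_natCast]
  push_cast
  ring

theorem aux_norm (y : ℝ) : ‖Complex.exp ((y : ℂ) * (2 * Real.pi * Complex.I))‖ = 1 := by
  have : (y : ℂ) * (2 * Real.pi * Complex.I) = ((y * (2 * Real.pi) : ℝ) : ℂ) * Complex.I := by
    push_cast; ring
  rw [this, Complex.norm_exp_ofReal_mul_I]

theorem aux_le (z : ℂ) (hz : ‖z‖ = 1) (M : ℕ) : ‖∑ m ∈ Finset.range M, z ^ m‖ ≤ M := by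
  refine (norm_sum_le _ _).trans ?_
  simp [hz]

theorem aux_eq (z : ℂ) (hz : ‖z‖ = 1) (M : ℕ) (hM : 2 ≤ M)
    (h : ‖∑ m ∈ Finset.range M, z ^ m‖ = M) : z = 1 := by
  obtain ⟨n, rfl⟩ := Nat.exists_eq_add_of_le hM
  rw [Finset.sum_range_add] at h
  have h1 : ‖∑ m ∈ Finset.range n, z ^ (2 + m)‖ ≤ n := by
    refine (norm_sum_le _ _).trans ?_
    simp [hz]
  have h2 := norm_add_le (∑ m ∈ Finset.range 2, z ^ m) (∑ m ∈ Finset.range n, z ^ (2 + m))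
  have h3 : ‖∑ m ∈ Finset.range 2, z ^ m‖ = ‖1 + z‖ := by simp [Finset.sum_range_succ]
  rw [h, h3] at h2
  push_cast at h2
  have h4 : 2 ≤ ‖1 + z‖ := by linarith
  have h5 : 4 ≤ Complex.normSq (1 + z) := by rw [Complex.normSq_eq_norm_sq]; nlinarith
  have h6 : Complex.normSq z = 1 := by rw [Complex.normSq_eq_norm_sq, hz]; norm_num
  rw [Complex.normSq_apply] at h5 h6
  simp at h5
  apply Complex.ext
  · simp; nlinarith [mul_self_nonneg z.im]
  · simp; nlinarith [mul_self_nonneg z.im]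

theorem aux_int (x : ℝ) :
    Complex.exp (((-x : ℝ) : ℂ) * (2 * Real.pi * Complex.I)) = 1 ↔ ∃ k : ℤ, x = k := by
  rw [Complex.exp_eq_one_iff]
  constructor
  · rintro ⟨n, hn⟩
    have := mul_right_cancel₀ Complex.two_pi_I_ne_zero hn
    have h : (-x : ℝ) = n := by exact_mod_cast this
    exact ⟨-n, by push_cast; linarith⟩
  · rintro ⟨k, rfl⟩
    exact ⟨-k, by push_cast; ring⟩

/-- `ρ(φ) = |⟨a_M(θ_u − φ), a_M(θ_s − φ)⟩|/M ≤ 1` for all `φ`; if `M ≥ 2`,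
`ρ(φ) = 1` iff `sin ζ₁ · cos(ζ₂ − φ) ∈ ℤ`; and the supremum of `ρ` over `φ ∈ ℝ` equals `1`. -/
theorem stmt_5 (M : ℕ) (hM : 0 < M) (θu θs : ℝ)
    (ζ1 ζ2 : ℝ) (hζ1 : ζ1 = (θu - θs) / 2) (hζ2 : ζ2 = (θu + θs) / 2)
    (ρ : ℝ → ℝ) (hρ : ρ = fun φ => ‖⟪steer M (θu - φ), steer M (θs - φ)⟫‖ / M) :
    (∀ φ : ℝ, ρ φ ≤ 1) ∧
    (2 ≤ M → ∀ φ : ℝ, (ρ φ = 1 ↔ ∃ k : ℤ, Real.sin ζ1 * Real.cos (ζ2 - φ) = k)) ∧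
    IsLUB (Set.range ρ) 1 := by
  have hM' : (0 : ℝ) < M := by exact_mod_cast hM
  have key : ∀ φ, ρ φ = ‖∑ m ∈ Finset.range M, (Complex.exp
      (((-(Real.sin ζ1 * Real.cos (ζ2 - φ)) : ℝ) : ℂ) * (2 * Real.pi * Complex.I))) ^ m‖ / M := by
    intro φ
    rw [hρ]
    simp only
    rw [aux_inner M _ _ (Real.sin ζ1 * Real.cos (ζ2 - φ))]
    have e1 : θu - φ = (ζ2 - φ) + ζ1 := by rw [hζ1, hζ2]; ring
    have e2 : θs - φ = (ζ2 - φ) - ζ1 := by rw [hζ1, hζ2]; ring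
    rw [e1, e2, Real.sin_add, Real.sin_sub]
    ring
  have hle : ∀ φ : ℝ, ρ φ ≤ 1 := by
    intro φ
    rw [key, div_le_one hM']
    exact aux_le _ (aux_norm _) M
  have hback : ∀ φ : ℝ, (∃ k : ℤ, Real.sin ζ1 * Real.cos (ζ2 - φ) = k) → ρ φ = 1 := by
    intro φ h
    rw [key, (aux_int _).2 h]
    simp [hM'.ne']
  refine ⟨hle, fun h2 φ => ⟨fun h => ?_, hback φ⟩, ?_, ?_⟩
  · rw [key, div_eq_one_iff_eq hM'.ne'] at h
    exact (aux_int _).1 (aux_eq _ (aux_norm _) M h2 h)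
  · rintro _ ⟨φ, rfl⟩
    exact hle φ
  · intro b hb
    rw [← hback (ζ2 - Real.pi / 2) ⟨0, by simp⟩]
    exact hb ⟨_, rfl⟩
end
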